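/- arXiv:0705.3045 — 2 statements merged into one kernel-verified Lean document; each statement's English description precedes it below -/
import Mathlib

section
/- Let V ∈ H₊^{−m} be a 1-periodic distribution and m ∈ ℕ. For every δ > 0 there exists a constant c_δ ≥ 0 such that for all u ∈ H₊^m, |⟨V·u, u⟩₊| ≤ δ ⟨D₊^{2m}u, u⟩₊ + c_δ ‖u‖²_{L²(0,1)}. In other words, the form u ↦ ⟨Vu,u⟩₊ is relatively bounded with relative bound zero with respect to the form u ↦ ⟨D₊^{2m}u,u⟩₊. -/
/- STATEMENT 4 (Proposition: V ≺≺ D₊^{2m}):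
For V ∈ H₊^{−m} and every δ > 0 there is c_δ ≥ 0 with
|⟨V·u,u⟩₊| ≤ δ ⟨D₊^{2m}u,u⟩₊ + c_δ‖u‖²_{L²} for all u ∈ H₊^m.
Everything is expressed via Fourier coefficients: u ∈ H₊^m is the
sequence (û(2k)), V the sequence (V̂(2k)); the pairing
⟨V·u,u⟩₊ = Σ_{k,j} V̂(2(k−j)) û(2j) conj(û(2k)), and
⟨D₊^{2m}u,u⟩₊ = Σ_k (2kπ)^{2m}|û(2k)|², ‖u‖²_{L²} = Σ_k |û(2k)|². -/

noncomputable section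
open Complex

/-- The weight `⟨2k⟩^{2s} = (1+|2k|)^{2s}` of the space `H₊^s`. -/
def wtp (s : ℝ) (k : ℤ) : ℝ := ((1 + |(2 * k : ℤ)| : ℝ)) ^ (2 * s)

theorem wq_summable : Summable fun k : ℤ => (√(1 + |(2 * k : ℤ)| : ℝ) ^ 3)⁻¹ := by
  have h1 : Summable fun k : ℤ => |(k : ℝ)| ^ (-(3 / 2 : ℝ)) :=
    Real.summable_abs_int_rpow (by norm_num)
  have h2 : Summable fun k : ℤ => if k = 0 then (1 : ℝ) else 0 :=
    (hasSum_ite_eq 0 1).summable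
  refine Summable.of_nonneg_of_le (fun k => by positivity) (fun k => ?_) (h1.add h2)
  by_cases hk : k = 0
  · subst hk
    simp
  · have hk0 : 0 < |(k : ℝ)| := by simpa using hk
    simp only [hk, if_false, add_zero]
    rw [Real.rpow_neg hk0.le, show (3 / 2 : ℝ) = (1 / 2) * (3 : ℕ) by norm_num, Real.rpow_mul hk0.le,
      Real.rpow_natCast, ← Real.sqrt_eq_rpow]
    have : 0 < √|(k : ℝ)| := Real.sqrt_pos.2 hk0
    gcongr
    push_cast
    rw [abs_mul, abs_two]
    linarith

theorem hasSum_prod_aux {f g : ℤ → ℝ} {F G : ℝ} (hf : HasSum f F) (hg : HasSum g G)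
    (hf0 : ∀ k, 0 ≤ f k) (hg0 : ∀ k, 0 ≤ g k) :
    HasSum (fun p : ℤ × ℤ => f p.1 * g p.2) (F * G) :=
  hf.mul hg (hf.summable.mul_of_nonneg hg.summable hf0 hg0)

def shiftA : ℤ × ℤ ≃ ℤ × ℤ where
  toFun p := (p.1, p.1 - p.2)
  invFun p := (p.1, p.1 - p.2)
  left_inv p := by simp
  right_inv p := by simp

def shiftB : ℤ × ℤ ≃ ℤ × ℤ where
  toFun p := (p.2, p.1 - p.2)
  invFun p := (p.1 + p.2, p.1)
  left_inv p := by simp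
  right_inv p := by simp

theorem cube_bound (η τ : ℝ) (hη : 0 < η) (hτ : 0 < τ) :
    ∃ C ≥ (0 : ℝ), ∀ r ≥ (0 : ℝ), r ^ 3 / τ ≤ η * r ^ 4 + C := by
  refine ⟨(1 / (η * τ)) ^ 3 / τ, by positivity, fun r hr => ?_⟩
  rcases le_total r (1 / (η * τ)) with h | h
  · have : r ^ 3 / τ ≤ (1 / (η * τ)) ^ 3 / τ := by gcongr
    have : 0 ≤ η * r ^ 4 := by positivity
    linarith
  · have h1 : 1 ≤ r * (η * τ) := by rwa [div_le_iff₀ (by positivity)] at h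
    have h2 : r ^ 3 / τ ≤ η * r ^ 4 := by
      rw [div_le_iff₀ hτ]
      have : 0 ≤ r ^ 3 := by positivity
      nlinarith
    have : 0 ≤ (1 / (η * τ)) ^ 3 / τ := by positivity
    linarith

theorem amgm_aux (t q x b a : ℝ) (hq : 0 ≤ q) (h : t * q = 1) :
    2 * (x * b * a) ≤ t * b ^ 2 + q * a ^ 2 * x ^ 2 := by
  have h1 : 0 ≤ q * (t * b - a * x) ^ 2 := by positivity
  have h2 : q * (t * b - a * x) ^ 2 = (t * q) * (t * b ^ 2) - 2 * (t * q) * (x * b * a)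
      + q * a ^ 2 * x ^ 2 := by ring
  rw [h2, h] at h1
  linarith

theorem relative_bound_zero (m : ℕ) (hm : 1 ≤ m) (V : ℤ → ℂ)
    (hV : Summable fun k : ℤ => wtp (-(m : ℝ)) k * ‖V k‖ ^ 2) :
    ∀ δ > (0 : ℝ), ∃ c ≥ (0 : ℝ), ∀ u : ℤ → ℂ,
      (Summable fun k : ℤ => wtp (m : ℝ) k * ‖u k‖ ^ 2) →
      ‖∑' p : ℤ × ℤ, V (p.1 - p.2) * u p.2 * (starRingEnd ℂ) (u p.1)‖ ≤
        δ * (∑' k : ℤ, (2 * Real.pi * (k : ℝ)) ^ (2 * m) * ‖u k‖ ^ 2) +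
          c * ∑' k : ℤ, ‖u k‖ ^ 2 := by
  intro δ hδ
  obtain ⟨w, hw⟩ : ∃ w : ℤ → ℝ, w = fun k => (1 + |(2 * k : ℤ)| : ℝ) := ⟨_, rfl⟩
  have hw1 : ∀ k, 1 ≤ w k := fun k => by
    rw [hw]
    have := abs_nonneg (((2 * k : ℤ)) : ℝ)
    simp only [Int.cast_abs]
    linarith
  have hw0 : ∀ k, 0 < w k := fun k => lt_of_lt_of_le one_pos (hw1 k)
  have hwp : ∀ k, wtp (m : ℝ) k = (w k ^ m) ^ 2 := fun k => by
    have : wtp (m : ℝ) k = w k ^ (2 * (m : ℝ)) := by rw [hw]; rfl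
    rw [this, ← pow_mul, ← Real.rpow_natCast]
    push_cast
    rw [mul_comm]
  have hwn : ∀ k, wtp (-(m : ℝ)) k = ((w k ^ m) ^ 2)⁻¹ := fun k => by
    have : wtp (-(m : ℝ)) k = w k ^ (2 * (-(m : ℝ))) := by rw [hw]; rfl
    rw [this, mul_neg, Real.rpow_neg (hw0 k).le, ← pow_mul, ← Real.rpow_natCast]
    push_cast
    rw [mul_comm]
  have hwadd : ∀ k j, w (k - j) ≤ w k + w j := fun k j => by
    rw [hw]
    have := abs_sub (((2 * k : ℤ)) : ℝ) (((2 * j : ℤ)) : ℝ)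
    have e : (((2 * (k - j) : ℤ)) : ℝ) = ((2 * k : ℤ) : ℝ) - ((2 * j : ℤ) : ℝ) := by
      push_cast; ring
    simp only [Int.cast_abs, e]
    linarith
  obtain ⟨x, hx⟩ : ∃ x : ℤ → ℝ, x = fun k => ‖V k‖ / w k ^ m := ⟨_, rfl⟩
  have hx0 : ∀ k, 0 ≤ x k := fun k => by
    rw [hx]; have := hw0 k; positivity
  have hxV : ∀ k, ‖V k‖ = x k * w k ^ m := fun k => by
    rw [hx]; have := (hw0 k).ne'; field_simp
  have hxs : Summable fun k => x k ^ 2 := by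
    refine hV.congr fun k => ?_
    rw [hwn, hx]
    simp only [div_pow]
    field_simp
  obtain ⟨X, hX⟩ := hxs
  have hX0 : 0 ≤ X := hX.nonneg fun k => by positivity
  obtain ⟨S, hS⟩ := wq_summable
  have hS0 : 0 ≤ S := hS.nonneg fun k => by positivity
  obtain ⟨P, hP⟩ : ∃ P : ℝ, P = 2 ^ (m - 1) := ⟨_, rfl⟩
  have hP0 : 0 < P := by rw [hP]; positivity
  obtain ⟨τ, hτdef⟩ : ∃ τ : ℝ, τ = δ / (2 * P * (S + 1)) := ⟨_, rfl⟩
  obtain ⟨η, hηdef⟩ : ∃ η : ℝ, η = δ / (2 * P * (X + 1)) := ⟨_, rfl⟩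
  have hτ : 0 < τ := by rw [hτdef]; positivity
  have hη : 0 < η := by rw [hηdef]; positivity
  have hτS : P * (τ * S) ≤ δ / 2 := by
    have : P * (τ * (S + 1)) = δ / 2 := by rw [hτdef]; field_simp
    have : 0 < P * τ := by positivity
    nlinarith
  have hηX : P * (η * X) ≤ δ / 2 := by
    have : P * (η * (X + 1)) = δ / 2 := by rw [hηdef]; field_simp
    have : 0 < P * η := by positivity
    nlinarith
  obtain ⟨C, hC0, hC⟩ := cube_bound η τ hη hτ
  refine ⟨δ + P * X * C, by positivity, fun u hu => ?_⟩
  obtain ⟨q, hq⟩ : ∃ q : ℤ → ℝ, q = fun k => √(w k) ^ 3 / τ := ⟨_, rfl⟩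
  obtain ⟨t, ht⟩ : ∃ t : ℤ → ℝ, t = fun k => τ * (√(w k) ^ 3)⁻¹ := ⟨_, rfl⟩
  have hr0 : ∀ k, 0 < √(w k) := fun k => Real.sqrt_pos.2 (hw0 k)
  have hq0 : ∀ k, 0 ≤ q k := fun k => by rw [hq]; have := hr0 k; positivity
  have ht0 : ∀ k, 0 ≤ t k := fun k => by rw [ht]; have := hr0 k; positivity
  have htq : ∀ k, t k * q k = 1 := fun k => by
    rw [ht, hq]; have := (hr0 k).ne'; field_simp
  have htS : HasSum t (τ * S) := by
    rw [ht, hw]; exact hS.mul_left τ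
  have hqb : ∀ k, q k ≤ η * (w k ^ m) ^ 2 + C := fun k => by
    have h1 := hC (√(w k)) (hr0 k).le
    have h2 : √(w k) ^ 4 = w k ^ 2 := by
      rw [show 4 = 2 * 2 by norm_num, pow_mul, Real.sq_sqrt (hw0 k).le]
    have h3 : w k ^ 2 ≤ (w k ^ m) ^ 2 := by
      have := le_self_pow₀ (hw1 k) (show m ≠ 0 by omega)
      have := hw0 k
      gcongr
    rw [h2] at h1
    rw [hq]
    have := mul_le_mul_of_nonneg_left h3 hη.le
    simp only
    linarith
  have hbs : Summable fun k => (w k ^ m * ‖u k‖) ^ 2 := by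
    refine hu.congr fun k => ?_
    rw [hwp, mul_pow]
  have has : Summable fun k => ‖u k‖ ^ 2 := by
    refine Summable.of_nonneg_of_le (fun k => by positivity) (fun k => ?_) hbs
    have := one_le_pow₀ (hw1 k) (n := m)
    have h2 := norm_nonneg (u k)
    gcongr
    nlinarith
  obtain ⟨B, hB⟩ := hbs
  have hB0 : 0 ≤ B := hB.nonneg fun k => by positivity
  obtain ⟨A, hA⟩ := has
  have hA0 : 0 ≤ A := hA.nonneg fun k => by positivity
  have hqa : ∀ k, q k * ‖u k‖ ^ 2 ≤ η * (w k ^ m * ‖u k‖) ^ 2 + C * ‖u k‖ ^ 2 := fun k => by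
    have := mul_le_mul_of_nonneg_right (hqb k) (sq_nonneg ‖u k‖)
    linarith
  have hqa0 : ∀ k, 0 ≤ q k * ‖u k‖ ^ 2 := fun k => mul_nonneg (hq0 k) (sq_nonneg _)
  have hsum := (hB.mul_left η).add (hA.mul_left C)
  obtain ⟨Q, hQ⟩ := Summable.of_nonneg_of_le hqa0 hqa hsum.summable
  have hQle : Q ≤ η * B + C * A := hasSum_le hqa hQ hsum
  -- bound of `B`
  have hpiw : ∀ k : ℤ, k ≠ 0 → w k ≤ |2 * Real.pi * (k : ℝ)| := fun k hk => by
    have h1 : (1 : ℝ) ≤ |(k : ℝ)| := by exact_mod_cast Int.one_le_abs hk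
    rw [hw]
    push_cast
    rw [abs_mul, abs_mul, abs_mul, abs_two, abs_of_pos Real.pi_pos]
    nlinarith [Real.pi_gt_three]
  have hDle : ∀ k : ℤ, (2 * Real.pi * (k : ℝ)) ^ (2 * m) * ‖u k‖ ^ 2
      ≤ (2 * Real.pi) ^ (2 * m) * (w k ^ m * ‖u k‖) ^ 2 := fun k => by
    have h1 : ((k : ℝ)) ^ (2 * m) ≤ (w k ^ m) ^ 2 := by
      rw [← pow_mul, mul_comm m 2, ← Even.pow_abs (even_two_mul m)]
      gcongr
      rw [hw]
      push_cast
      rw [abs_mul, abs_two]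
      have := abs_nonneg (k : ℝ)
      linarith
    rw [mul_pow, mul_pow (w k ^ m), mul_assoc]
    gcongr
  have hDs : Summable fun k : ℤ => (2 * Real.pi * (k : ℝ)) ^ (2 * m) * ‖u k‖ ^ 2 :=
    Summable.of_nonneg_of_le
      (fun k => mul_nonneg ((even_two_mul m).pow_nonneg _) (sq_nonneg _)) hDle
      (hB.summable.mul_left _)
  obtain ⟨D, hD⟩ := hDs
  have hBD : B ≤ D + A := by
    refine hasSum_le (fun k => ?_) hB (hD.add hA)
    have h3 : (w k ^ m) ^ 2 ≤ (2 * Real.pi * (k : ℝ)) ^ (2 * m) + 1 := by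
      by_cases hk : k = 0
      · subst hk
        have : (0 : ℝ) ≤ (2 * Real.pi * ((0 : ℤ) : ℝ)) ^ (2 * m) := (even_two_mul m).pow_nonneg _
        have e : w 0 = 1 := by rw [hw]; simp
        rw [e, one_pow, one_pow]
        linarith
      · rw [← pow_mul, mul_comm m 2, ← Even.pow_abs (even_two_mul m) (2 * Real.pi * (k : ℝ))]
        have := pow_le_pow_left₀ (hw0 k).le (hpiw k hk) (2 * m)
        linarith
    have := mul_le_mul_of_nonneg_right h3 (sq_nonneg ‖u k‖)
    rw [mul_pow]
    linarith
  have g1 := hasSum_prod_aux hB htS (fun k => sq_nonneg _) ht0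
  have g2 := hasSum_prod_aux htS hB ht0 (fun k => sq_nonneg _)
  have g0 := hasSum_prod_aux hQ hX hqa0 (fun k => sq_nonneg _)
  have g3 := (shiftA.hasSum_iff).2 g0
  have g4 := (shiftB.hasSum_iff).2 g0
  have G := (((g1.add g4).add (g2.add g3)).mul_left (P / 2))
  have key := tsum_of_norm_bounded
    (f := fun p : ℤ × ℤ => V (p.1 - p.2) * u p.2 * (starRingEnd ℂ) (u p.1)) G ?_
  · rw [hD.tsum_eq, hA.tsum_eq]
    refine key.trans ?_
    have e : P / 2 * (B * (τ * S) + Q * X + (τ * S * B + Q * X))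
        = P * (τ * S) * B + P * X * Q := by ring
    rw [e]
    have s1 : P * (τ * S) * B ≤ δ / 2 * B := mul_le_mul_of_nonneg_right hτS hB0
    have s2 : P * X * Q ≤ P * X * (η * B + C * A) :=
      mul_le_mul_of_nonneg_left hQle (by positivity)
    have s3 : P * (η * X) * B ≤ δ / 2 * B := mul_le_mul_of_nonneg_right hηX hB0
    have s4 := mul_le_mul_of_nonneg_left hBD hδ.le
    linarith
  · rintro ⟨k, j⟩
    simp only [Function.comp, shiftA, shiftB, Equiv.coe_fn_mk, norm_mul, RCLike.norm_conj]
    rw [hxV]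
    have n1 : w (k - j) ^ m ≤ P * (w k ^ m + w j ^ m) := by
      rw [hP]
      exact (pow_le_pow_left₀ (hw0 _).le (hwadd k j) m).trans
        (add_pow_le (hw0 k).le (hw0 j).le m)
    have a1 := amgm_aux (t j) (q j) (x (k - j)) (w k ^ m * ‖u k‖) ‖u j‖ (hq0 j) (htq j)
    have a2 := amgm_aux (t k) (q k) (x (k - j)) (w j ^ m * ‖u j‖) ‖u k‖ (hq0 k) (htq k)
    have n2 : 0 ≤ x (k - j) * ‖u j‖ * ‖u k‖ := by
      have := hx0 (k - j)
      positivity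
    have n3 := mul_le_mul_of_nonneg_left n1 n2
    have n4 := mul_le_mul_of_nonneg_left (add_le_add a1 a2) (show 0 ≤ P / 2 by positivity)
    linarith
end
end

section
/- Let V ∈ H₊^{−m}. For every ε > 0 there exists c_ε ≥ 0 such that |Im (S₊(V)u, u)| ≤ ε Re (S₊(V)u, u) + c_ε ‖u‖²_{L²(0,1)} for all u ∈ Dom(S₊(V)). Consequently S₊(V) is m-sectorial with respect to every sector around the positive half-axis of arbitrarily small angle. -/
/- STATEMENT 11: For V ∈ H₊^{−m} and every ε > 0 there is c_ε ≥ 0 with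
|Im (S₊u,u)| ≤ ε Re (S₊u,u) + c_ε‖u‖² on Dom(S₊); consequently S₊(V)
is m-sectorial with respect to every sector around the positive
half-axis: the exterior of the sector {λ : |Im λ| ≤ ε(Re λ + c_ε)}
belongs to the resolvent set.  Model: L²(0,1) ≅ ℓ²(ℤ); S₊(V) is
encoded by its graph. -/

noncomputable section
open Complex

abbrev E := lp (fun _ : ℤ => ℂ) 2

def conv (a b : ℤ → ℂ) (k : ℤ) : ℂ := ∑' j : ℤ, a (k - j) * b j

def cplus (m : ℕ) (k : ℤ) : ℝ := (2 * Real.pi * (k : ℝ)) ^ (2 * m)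

/-- The graph of `S₊(V) = D₊^{2m} ∔ V` on `L²(0,1) ≅ ℓ²`. -/
def graphS (m : ℕ) (V : ℤ → ℂ) : Set (E × E) :=
  {p | (Summable fun k : ℤ => wtp (m : ℝ) k * ‖p.1 k‖ ^ 2) ∧
       ∀ k : ℤ, p.2 k = ((cplus m k : ℝ) : ℂ) * p.1 k +
          conv V (fun j => p.1 j) k}

/-- The `L²` inner product `(w,u)` in Fourier coordinates. -/
def L2inner (w u : E) : ℂ := ∑' k : ℤ, w k * (starRingEnd ℂ) (u k)

/-- `R` is the resolvent `(S−λ)⁻¹` of the operator with graph `G` at `λ`. -/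
def ResolventAt (G : Set (E × E)) (lam : ℂ) (R : E →L[ℂ] E) : Prop :=
  (∀ w : E, (R w, w + lam • R w) ∈ G) ∧
    ∀ p ∈ G, R (p.2 - lam • p.1) = p.1


/-! ### Helper lemmas -/

lemma cs_tsum {ι : Type*} (x y : ι → ℝ) (hx : ∀ i, 0 ≤ x i) (hy : ∀ i, 0 ≤ y i)
    (hxs : Summable fun i => x i ^ 2) (hys : Summable fun i => y i ^ 2) :
    (Summable fun i => x i * y i) ∧
      ∑' i, x i * y i ≤ √(∑' i, x i ^ 2) * √(∑' i, y i ^ 2) := by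
  have := Real.summable_and_inner_le_Lp_mul_Lq_tsum_of_nonneg (p := 2) (q := 2)
    Real.HolderConjugate.two_two hx hy (by simpa using hxs) (by simpa using hys)
  simpa [Real.sqrt_eq_rpow] using this

lemma E_summable (f : E) : Summable fun k => ‖f k‖ ^ 2 := by
  have := (lp.memℓp f).summable (by norm_num)
  simpa using this

lemma E_norm_sq (f : E) : ‖f‖ ^ 2 = ∑' k, ‖f k‖ ^ 2 := by
  have := lp.norm_rpow_eq_tsum (p := 2) (by norm_num) f
  simpa using this

lemma E_norm (f : E) : ‖f‖ = √(∑' k, ‖f k‖ ^ 2) := by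
  rw [← E_norm_sq, Real.sqrt_sq (norm_nonneg _)]

lemma E_mem (f : ℤ → ℂ) (h : Summable fun k => ‖f k‖ ^ 2) :
    Memℓp (E := fun _ : ℤ => ℂ) f 2 := by
  apply memℓp_gen
  simpa using h

lemma young (g a : ℤ → ℝ) (hg : ∀ i, 0 ≤ g i) (ha : ∀ i, 0 ≤ a i)
    (hgs : Summable fun i => g i ^ 2) (has : Summable a) :
    (Summable fun k => (∑' j, g (k - j) * a j) ^ 2) ∧
      ∑' k, (∑' j, g (k - j) * a j) ^ 2 ≤ (∑' j, a j) ^ 2 * ∑' i, g i ^ 2 := by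
  have h1 : Summable fun x : ℤ × ℤ => g x.1 ^ 2 * a x.2 :=
    hgs.mul_of_nonneg has (fun i => sq_nonneg _) ha
  let e : ℤ × ℤ ≃ ℤ × ℤ :=
    { toFun := fun x => (x.1 - x.2, x.2)
      invFun := fun x => (x.1 + x.2, x.2)
      left_inv := fun x => by simp
      right_inv := fun x => by simp }
  have h2 : Summable fun x : ℤ × ℤ => g (x.1 - x.2) ^ 2 * a x.2 := e.summable_iff.mpr h1
  have h3 : ∀ k, Summable fun j => g (k - j) ^ 2 * a j := fun k => h2.prod_factor k
  have h4 : Summable fun k => ∑' j, g (k - j) ^ 2 * a j := h2.prod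
  have h5 : ∑' k, ∑' j, g (k - j) ^ 2 * a j = (∑' i, g i ^ 2) * ∑' j, a j := by
    have e1 := Summable.tsum_comm (f := fun k j => g (k - j) ^ 2 * a j) h2
    rw [← e1, ← tsum_mul_left]
    congr 1
    ext j
    rw [tsum_mul_right]
    congr 1
    exact (Equiv.subRight j).tsum_eq (fun i => g i ^ 2)
  have h6 : ∀ k, (∑' j, g (k - j) * a j) ^ 2 ≤ (∑' j, a j) * ∑' j, g (k - j) ^ 2 * a j := by
    intro k
    have := (cs_tsum (fun j => √(a j)) (fun j => g (k - j) * √(a j)) (fun j => Real.sqrt_nonneg _)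
      (fun j => mul_nonneg (hg _) (Real.sqrt_nonneg _))
      (by simpa [Real.sq_sqrt (ha _)] using has)
      (by simpa [mul_pow, Real.sq_sqrt (ha _)] using h3 k)).2
    have e2 : ∀ j, √(a j) * (g (k - j) * √(a j)) = g (k - j) * a j := fun j => by
      have := Real.mul_self_sqrt (ha j)
      linear_combination g (k - j) * this
    simp only [e2, mul_pow, Real.sq_sqrt (ha _)] at this
    have n1 : 0 ≤ ∑' j, g (k - j) * a j := tsum_nonneg fun j => mul_nonneg (hg _) (ha _)
    calc _ ≤ (√(∑' j, a j) * √(∑' j, g (k - j) ^ 2 * a j)) ^ 2 := by gcongr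
      _ = _ := by
        rw [mul_pow, Real.sq_sqrt (tsum_nonneg ha),
          Real.sq_sqrt (tsum_nonneg fun j => mul_nonneg (sq_nonneg _) (ha _))]
  have h7 := h4.mul_left (∑' j, a j)
  have h8 : Summable fun k => (∑' j, g (k - j) * a j) ^ 2 :=
    Summable.of_nonneg_of_le (fun k => sq_nonneg _) h6 h7
  refine ⟨h8, (h8.tsum_le_tsum h6 h7).trans ?_⟩
  rw [tsum_mul_left, h5]
  exact le_of_eq (by ring)

/-- Abstract weight hypotheses. -/
structure Wt (om : ℤ → ℝ) (C : ℝ) : Prop where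
  one_le : ∀ k, 1 ≤ om k
  sub_le : ∀ k j, om (k - j) ≤ C * (om k + om j)
  C_nonneg : 0 ≤ C
  summ : Summable fun k => ((om k)⁻¹) ^ 2

lemma exists_mul (d : ℤ → ℝ) (K : ℝ) (hd : ∀ k, |d k| ≤ K) :
    ∃ M : E →L[ℂ] E, ∀ f k, M f k = (d k : ℂ) * f k := by
  have hK : 0 ≤ K := (abs_nonneg _).trans (hd 0)
  have hle : ∀ (f : E) k, ‖(d k : ℂ) * f k‖ ^ 2 ≤ K ^ 2 * ‖f k‖ ^ 2 := fun f k => by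
    rw [norm_mul, mul_pow]
    have := hd k
    gcongr
    simpa using this
  have hs : ∀ f : E, Summable fun k => ‖(d k : ℂ) * f k‖ ^ 2 := fun f =>
    Summable.of_nonneg_of_le (fun k => sq_nonneg _) (hle f) ((E_summable f).mul_left _)
  let L : E →ₗ[ℂ] E :=
    { toFun := fun f => ⟨fun k => (d k : ℂ) * f k, E_mem _ (hs f)⟩
      map_add' := fun f g => by
        ext k
        simp [mul_add]
        rfl
      map_smul' := fun c f => by
        ext k
        simp
        ring }
  refine ⟨L.mkContinuous K fun f => ?_, fun f k => rfl⟩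
  rw [← sq_le_sq₀ (norm_nonneg _) (by positivity), E_norm_sq, mul_pow, E_norm_sq, ← tsum_mul_left]
  exact (hs f).tsum_le_tsum (hle f) ((E_summable f).mul_left _)

section
variable {om : ℤ → ℝ} {C : ℝ}

lemma l1_bound (h : Wt om C) (f : E) :
    (Summable fun k => (om k)⁻¹ * ‖f k‖) ∧
      ∑' k, (om k)⁻¹ * ‖f k‖ ≤ √(∑' k, ((om k)⁻¹) ^ 2) * ‖f‖ := by
  have := cs_tsum (fun k => (om k)⁻¹) (fun k => ‖f k‖)
    (fun k => inv_nonneg.mpr (zero_le_one.trans (h.one_le k))) (fun k => norm_nonneg _)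
    h.summ (E_summable f)
  rwa [← E_norm] at this

lemma l1_small (h : Wt om C) (η : ℝ) (hη : 0 < η) :
    ∃ D : ℝ, 0 ≤ D ∧ ∀ f F : E, (∀ k, F k = ((om k)⁻¹ : ℝ) * f k) →
      ∑' k, (om k)⁻¹ * ‖f k‖ ≤ η * ‖f‖ + D * ‖F‖ := by
  have hpos : ∀ k, 0 ≤ (om k)⁻¹ := fun k => inv_nonneg.mpr (zero_le_one.trans (h.one_le k))
  have ht := tendsto_tsum_compl_atTop_zero (fun k => ((om k)⁻¹) ^ 2)
  obtain ⟨s, hs⟩ := (ht.eventually_lt_const (show (0:ℝ) < η ^ 2 by positivity)).exists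
  classical
  let r : ℤ → ℝ := fun k => if k ∈ s then 0 else (om k)⁻¹
  let q : ℤ → ℝ := fun k => if k ∈ s then 1 else 0
  have hq : Summable fun k => q k ^ 2 := by
    refine summable_of_ne_finset_zero (s := s) fun k hk => ?_
    simp [q, hk]
  have hr0 : ∀ k, r k ^ 2 = ({x | x ∉ s} : Set ℤ).indicator (fun k => ((om k)⁻¹) ^ 2) k := by
    intro k
    by_cases hk : k ∈ s <;> simp [r, hk]
  have hr : Summable fun k => r k ^ 2 := by
    simp only [hr0]
    exact h.summ.indicator _
  have hrs : ∑' k, r k ^ 2 < η ^ 2 := by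
    simp only [hr0]
    rw [← tsum_subtype]
    exact hs
  refine ⟨√(∑' k, q k ^ 2), Real.sqrt_nonneg _, fun f F hF => ?_⟩
  have c1 := cs_tsum r (fun k => ‖f k‖) (fun k => by
    simp only [r]; split_ifs; exacts [le_rfl, hpos k]) (fun k => norm_nonneg _) hr (E_summable f)
  have c2 := cs_tsum q (fun k => ‖F k‖) (fun k => by
    simp only [q]; split_ifs <;> norm_num) (fun k => norm_nonneg _) hq (E_summable F)
  rw [← E_norm] at c1 c2
  have e : ∀ k, (om k)⁻¹ * ‖f k‖ = r k * ‖f k‖ + q k * ‖F k‖ := by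
    intro k
    rw [hF, norm_mul, Complex.norm_real, Real.norm_of_nonneg (hpos k)]
    by_cases hk : k ∈ s <;> simp [r, q, hk]
  simp only [e]
  rw [c1.1.tsum_add c2.1]
  have : √(∑' k, r k ^ 2) ≤ η := by
    rw [Real.sqrt_le_left hη.le]; exact hrs.le
  have := mul_le_mul_of_nonneg_right this (norm_nonneg f)
  linarith [c1.2, c2.2]

lemma conv_bound (h : Wt om C) (V : ℤ → ℂ)
    (hV : Summable fun k => ((om k)⁻¹ * ‖V k‖) ^ 2) (f : E) (k : ℤ) :
    (Summable fun j => V (k - j) * (((om j)⁻¹ : ℝ) * f j)) ∧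
    (Summable fun j => ((om (k - j))⁻¹ * ‖V (k - j)‖) * ((om j)⁻¹ * ‖f j‖)) ∧
    (om k)⁻¹ * ‖conv V (fun j => ((om j)⁻¹ : ℝ) * f j) k‖ ≤
      C * (∑' j, ((om (k - j))⁻¹ * ‖V (k - j)‖) * ((om j)⁻¹ * ‖f j‖) +
        (om k)⁻¹ * (√(∑' k, ((om k)⁻¹ * ‖V k‖) ^ 2) * ‖f‖)) := by
  have hp : ∀ k, 0 < om k := fun k => zero_lt_one.trans_le (h.one_le k)
  set g : ℤ → ℝ := fun k => (om k)⁻¹ * ‖V k‖ with hg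
  have hg0 : ∀ k, 0 ≤ g k := fun k => mul_nonneg (inv_nonneg.mpr (hp k).le) (norm_nonneg _)
  have hgk : Summable fun j => g (k - j) ^ 2 := (Equiv.subLeft k).summable_iff.mpr hV
  have hgke : ∑' j, g (k - j) ^ 2 = ∑' j, g j ^ 2 := (Equiv.subLeft k).tsum_eq (fun j => g j ^ 2)
  have c1 := cs_tsum (fun j => g (k - j)) (fun j => ‖f j‖) (fun j => hg0 _)
    (fun j => norm_nonneg _) hgk (E_summable f)
  rw [← E_norm, hgke] at c1
  have s2 : Summable fun j => g (k - j) * ((om j)⁻¹ * ‖f j‖) := by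
    refine Summable.of_nonneg_of_le (fun j => mul_nonneg (hg0 _)
      (mul_nonneg (inv_nonneg.mpr (hp j).le) (norm_nonneg _))) (fun j => ?_) c1.1
    have : (om j)⁻¹ ≤ 1 := inv_le_one_of_one_le₀ (h.one_le j)
    have := mul_le_mul_of_nonneg_right this (norm_nonneg (f j))
    exact mul_le_mul_of_nonneg_left (by linarith) (hg0 _)
  have hle : ∀ j, ‖V (k - j) * (((om j)⁻¹ : ℝ) * f j)‖ ≤
      C * om k * (g (k - j) * ((om j)⁻¹ * ‖f j‖)) + C * (g (k - j) * ‖f j‖) := by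
    intro j
    have e1 : ‖V (k - j)‖ = om (k - j) * g (k - j) := by
      simp only [hg]; field_simp [(hp (k - j)).ne']
    rw [norm_mul, norm_mul, Complex.norm_real, Real.norm_of_nonneg (inv_nonneg.mpr (hp j).le), e1]
    have n : 0 ≤ g (k - j) * ((om j)⁻¹ * ‖f j‖) :=
      mul_nonneg (hg0 _) (mul_nonneg (inv_nonneg.mpr (hp j).le) (norm_nonneg _))
    have := mul_le_mul_of_nonneg_right (h.sub_le k j) n
    have e2 : om j * (om j)⁻¹ = 1 := mul_inv_cancel₀ (hp j).ne'
    calc _ = om (k - j) * (g (k - j) * ((om j)⁻¹ * ‖f j‖)) := by ring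
      _ ≤ _ := this
      _ = _ := by linear_combination C * g (k - j) * ‖f j‖ * e2
  have sR := (s2.mul_left (C * om k)).add (c1.1.mul_left C)
  have sN : Summable fun j => ‖V (k - j) * (((om j)⁻¹ : ℝ) * f j)‖ :=
    Summable.of_nonneg_of_le (fun j => norm_nonneg _) hle sR
  refine ⟨sN.of_norm, s2, ?_⟩
  have b1 : ‖conv V (fun j => ((om j)⁻¹ : ℝ) * f j) k‖ ≤
      C * om k * (∑' j, g (k - j) * ((om j)⁻¹ * ‖f j‖)) + C * (√(∑' k, g k ^ 2) * ‖f‖) := by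
    calc _ ≤ ∑' j, ‖V (k - j) * (((om j)⁻¹ : ℝ) * f j)‖ := norm_tsum_le_tsum_norm sN
      _ ≤ _ := sN.tsum_le_tsum hle sR
      _ = C * om k * (∑' j, g (k - j) * ((om j)⁻¹ * ‖f j‖)) + C * ∑' j, (g (k - j) * ‖f j‖) := by
        rw [(s2.mul_left (C * om k)).tsum_add (c1.1.mul_left C), tsum_mul_left, tsum_mul_left]
      _ ≤ _ := by gcongr; exacts [h.C_nonneg, c1.2]
  have := mul_le_mul_of_nonneg_left b1 (inv_nonneg.mpr (hp k).le)
  refine this.trans (le_of_eq ?_)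
  have e2 : (om k)⁻¹ * om k = 1 := inv_mul_cancel₀ (hp k).ne'
  linear_combination C * (∑' j, g (k - j) * ((om j)⁻¹ * ‖f j‖)) * e2

lemma exists_B (h : Wt om C) (V : ℤ → ℂ)
    (hV : Summable fun k => ((om k)⁻¹ * ‖V k‖) ^ 2) :
    ∃ B : E →L[ℂ] E, ∀ f k, B f k = ((om k)⁻¹ : ℝ) * conv V (fun j => ((om j)⁻¹ : ℝ) * f j) k := by
  have hp : ∀ k, 0 < om k := fun k => zero_lt_one.trans_le (h.one_le k)
  set g : ℤ → ℝ := fun k => (om k)⁻¹ * ‖V k‖ with hg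
  have hg0 : ∀ k, 0 ≤ g k := fun k => mul_nonneg (inv_nonneg.mpr (hp k).le) (norm_nonneg _)
  set G := √(∑' k, g k ^ 2) with hG
  set Om := √(∑' k, ((om k)⁻¹) ^ 2) with hOm
  have hG2 : ∑' k, g k ^ 2 = G ^ 2 := (Real.sq_sqrt (tsum_nonneg fun _ => sq_nonneg _)).symm
  have hO2 : ∑' k, ((om k)⁻¹) ^ 2 = Om ^ 2 :=
    (Real.sq_sqrt (tsum_nonneg fun _ => sq_nonneg _)).symm
  let S : E → ℤ → ℝ := fun f k => ∑' j, g (k - j) * ((om j)⁻¹ * ‖f j‖)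
  have hle : ∀ (f : E) k, ‖(((om k)⁻¹ : ℝ) : ℂ) * conv V (fun j => ((om j)⁻¹ : ℝ) * f j) k‖ ^ 2 ≤
      2 * C ^ 2 * (S f k ^ 2) + 2 * C ^ 2 * (G * ‖f‖) ^ 2 * ((om k)⁻¹) ^ 2 := by
    intro f k
    have := (conv_bound h V hV f k).2.2
    rw [norm_mul, Complex.norm_real, Real.norm_of_nonneg (inv_nonneg.mpr (hp k).le)]
    have n : 0 ≤ (om k)⁻¹ * ‖conv V (fun j => ((om j)⁻¹ : ℝ) * f j) k‖ :=
      mul_nonneg (inv_nonneg.mpr (hp k).le) (norm_nonneg _)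
    calc _ ≤ (C * (S f k + (om k)⁻¹ * (G * ‖f‖))) ^ 2 := by gcongr
      _ ≤ _ := by nlinarith [sq_nonneg (C * (S f k - (om k)⁻¹ * (G * ‖f‖)))]
  have hy : ∀ f : E, _ := fun f => young g (fun j => (om j)⁻¹ * ‖f j‖) hg0
    (fun j => mul_nonneg (inv_nonneg.mpr (hp j).le) (norm_nonneg _)) hV (l1_bound h f).1
  have hsR : ∀ f : E, Summable fun k => 2 * C ^ 2 * (S f k ^ 2) +
      2 * C ^ 2 * (G * ‖f‖) ^ 2 * ((om k)⁻¹) ^ 2 := fun f =>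
    ((hy f).1.mul_left _).add (h.summ.mul_left _)
  have hs : ∀ f : E, Summable fun k =>
      ‖(((om k)⁻¹ : ℝ) : ℂ) * conv V (fun j => ((om j)⁻¹ : ℝ) * f j) k‖ ^ 2 := fun f =>
    Summable.of_nonneg_of_le (fun k => sq_nonneg _) (hle f) (hsR f)
  let L : E →ₗ[ℂ] E :=
    { toFun := fun f => ⟨fun k => (((om k)⁻¹ : ℝ) : ℂ) * conv V (fun j => ((om j)⁻¹ : ℝ) * f j) k,
        E_mem _ (hs f)⟩
      map_add' := fun f f' => by
        ext k
        change (((om k)⁻¹ : ℝ) : ℂ) * conv V (fun j => ((om j)⁻¹ : ℝ) * (f j + f' j)) k =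
          (((om k)⁻¹ : ℝ) : ℂ) * conv V (fun j => ((om j)⁻¹ : ℝ) * f j) k +
          (((om k)⁻¹ : ℝ) : ℂ) * conv V (fun j => ((om j)⁻¹ : ℝ) * f' j) k
        rw [← mul_add]
        congr 1
        unfold conv
        rw [← (conv_bound h V hV f k).1.tsum_add (conv_bound h V hV f' k).1]
        congr 1
        ext j
        ring
      map_smul' := fun c f => by
        ext k
        change (((om k)⁻¹ : ℝ) : ℂ) * conv V (fun j => ((om j)⁻¹ : ℝ) * (c * f j)) k =
          c * ((((om k)⁻¹ : ℝ) : ℂ) * conv V (fun j => ((om j)⁻¹ : ℝ) * f j) k)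
        rw [mul_left_comm]
        congr 1
        unfold conv
        rw [← tsum_mul_left]
        congr 1
        ext j
        ring }
  have hC := h.C_nonneg
  refine ⟨L.mkContinuous (2 * C * G * Om) fun f => ?_, fun f k => rfl⟩
  rw [← sq_le_sq₀ (norm_nonneg _) (by positivity), E_norm_sq]
  have t1 : ∑' k, S f k ^ 2 ≤ (Om * ‖f‖) ^ 2 * G ^ 2 := by
    rw [← hG2]
    refine (hy f).2.trans ?_
    have := (l1_bound h f).2
    have n : 0 ≤ ∑' k, (om k)⁻¹ * ‖f k‖ := tsum_nonneg fun k =>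
      mul_nonneg (inv_nonneg.mpr (hp k).le) (norm_nonneg _)
    gcongr
  calc ∑' k, ‖L f k‖ ^ 2 ≤ ∑' k, (2 * C ^ 2 * (S f k ^ 2) +
      2 * C ^ 2 * (G * ‖f‖) ^ 2 * ((om k)⁻¹) ^ 2) := (hs f).tsum_le_tsum (hle f) (hsR f)
    _ = 2 * C ^ 2 * ∑' k, (S f k ^ 2) + 2 * C ^ 2 * (G * ‖f‖) ^ 2 * Om ^ 2 := by
      rw [((hy f).1.mul_left _).tsum_add (h.summ.mul_left _), tsum_mul_left, tsum_mul_left, hO2]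
    _ ≤ 2 * C ^ 2 * ((Om * ‖f‖) ^ 2 * G ^ 2) + 2 * C ^ 2 * (G * ‖f‖) ^ 2 * Om ^ 2 := by gcongr
    _ = _ := by ring

lemma form_bound (h : Wt om C) (V : ℤ → ℂ)
    (hV : Summable fun k => ((om k)⁻¹ * ‖V k‖) ^ 2) (B : E →L[ℂ] E)
    (hB : ∀ f k, B f k = ((om k)⁻¹ : ℝ) * conv V (fun j => ((om j)⁻¹ : ℝ) * f j) k) (f : E) :
    ‖inner ℂ f (B f)‖ ≤ 2 * C * √(∑' k, ((om k)⁻¹ * ‖V k‖) ^ 2) *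
      (∑' k, (om k)⁻¹ * ‖f k‖) * ‖f‖ := by
  have hp : ∀ k, 0 < om k := fun k => zero_lt_one.trans_le (h.one_le k)
  set g : ℤ → ℝ := fun k => (om k)⁻¹ * ‖V k‖ with hg
  have hg0 : ∀ k, 0 ≤ g k := fun k => mul_nonneg (inv_nonneg.mpr (hp k).le) (norm_nonneg _)
  set G := √(∑' k, g k ^ 2) with hG
  have hG2 : ∑' k, g k ^ 2 = G ^ 2 := (Real.sq_sqrt (tsum_nonneg fun _ => sq_nonneg _)).symm
  let S : ℤ → ℝ := fun k => ∑' j, g (k - j) * ((om j)⁻¹ * ‖f j‖)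
  set A := ∑' k, (om k)⁻¹ * ‖f k‖ with hA
  have hA0 : 0 ≤ A := tsum_nonneg fun k =>
      mul_nonneg (inv_nonneg.mpr (hp k).le) (norm_nonneg _)
  have hy := young g (fun j => (om j)⁻¹ * ‖f j‖) hg0
    (fun j => mul_nonneg (inv_nonneg.mpr (hp j).le) (norm_nonneg _)) hV (l1_bound h f).1
  have c1 := cs_tsum S (fun k => ‖f k‖) (fun k => tsum_nonneg fun j => mul_nonneg (hg0 _)
    (mul_nonneg (inv_nonneg.mpr (hp j).le) (norm_nonneg _))) (fun k => norm_nonneg _)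
    hy.1 (E_summable f)
  rw [← E_norm] at c1
  have hSn : √(∑' k, S k ^ 2) ≤ A * G := by
    rw [Real.sqrt_le_left (by positivity), mul_pow, ← hG2]
    exact hy.2
  have hle : ∀ k, ‖inner ℂ (f k) (B f k)‖ ≤
      C * (S k * ‖f k‖) + C * (G * ‖f‖) * ((om k)⁻¹ * ‖f k‖) := by
    intro k
    have b := (conv_bound h V hV f k).2.2
    refine (norm_inner_le_norm _ _).trans ?_
    rw [hB, norm_mul, Complex.norm_real, Real.norm_of_nonneg (inv_nonneg.mpr (hp k).le)]
    calc _ ≤ ‖f k‖ * (C * (S k + (om k)⁻¹ * (G * ‖f‖))) := by gcongr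
      _ = _ := by ring
  have sR := (c1.1.mul_left C).add ((l1_bound h f).1.mul_left (C * (G * ‖f‖)))
  have sN : Summable fun k => ‖inner ℂ (f k) (B f k)‖ :=
    Summable.of_nonneg_of_le (fun _ => norm_nonneg _) hle sR
  rw [lp.inner_eq_tsum]
  have hC := h.C_nonneg
  calc _ ≤ ∑' k, ‖inner ℂ (f k) (B f k)‖ := norm_tsum_le_tsum_norm sN
    _ ≤ _ := sN.tsum_le_tsum hle sR
    _ = C * (∑' k, S k * ‖f k‖) + C * (G * ‖f‖) * A := by
      rw [(c1.1.mul_left C).tsum_add ((l1_bound h f).1.mul_left _), tsum_mul_left, tsum_mul_left]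
    _ ≤ C * (A * G * ‖f‖) + C * (G * ‖f‖) * A := by
      gcongr
      exact c1.2.trans (by gcongr)
    _ = _ := by ring

lemma form_small (h : Wt om C) (V : ℤ → ℂ)
    (hV : Summable fun k => ((om k)⁻¹ * ‖V k‖) ^ 2) (B : E →L[ℂ] E)
    (hB : ∀ f k, B f k = ((om k)⁻¹ : ℝ) * conv V (fun j => ((om j)⁻¹ : ℝ) * f j) k)
    (W : E →L[ℂ] E) (hW : ∀ f k, W f k = ((om k)⁻¹ : ℝ) * f k) (η : ℝ) (hη : 0 < η) :
    ∃ D : ℝ, 0 ≤ D ∧ ∀ f, ‖inner ℂ f (B f)‖ ≤ η * ‖f‖ ^ 2 + D * ‖W f‖ ^ 2 := by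
  have hb := form_bound h V hV B hB
  have hC := h.C_nonneg
  set P := 2 * C * √(∑' k, ((om k)⁻¹ * ‖V k‖) ^ 2) with hP
  have hP0 : 0 ≤ P := by positivity
  obtain ⟨D, hD, hD'⟩ := l1_small h (η / (2 * (P + 1))) (by positivity)
  refine ⟨(P * D) ^ 2 / (2 * η), by positivity, fun f => (hb f).trans ?_⟩
  have := hD' f (W f) (hW f)
  calc P * (∑' k, (om k)⁻¹ * ‖f k‖) * ‖f‖
      ≤ P * (η / (2 * (P + 1)) * ‖f‖ + D * ‖W f‖) * ‖f‖ := by gcongr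
    _ = (P / (P + 1)) * (η / 2) * ‖f‖ ^ 2 + (P * D) * ‖W f‖ * ‖f‖ := by field_simp
    _ ≤ 1 * (η / 2) * ‖f‖ ^ 2 + (P * D) * ‖W f‖ * ‖f‖ := by
      gcongr
      rw [div_le_one (by positivity)]
      linarith
    _ ≤ _ := by
      have e : η * ‖f‖ ^ 2 + (P * D) ^ 2 / (2 * η) * ‖W f‖ ^ 2 -
          (1 * (η / 2) * ‖f‖ ^ 2 + (P * D) * ‖W f‖ * ‖f‖) =
          (η * ‖f‖ - P * D * ‖W f‖) ^ 2 / (2 * η) := by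
        field_simp
        ring
      have : 0 ≤ (η * ‖f‖ - P * D * ‖W f‖) ^ 2 / (2 * η) := by positivity
      linarith

lemma coercive_equiv (T : E →L[ℂ] E) (δ : ℝ) (hδ : 0 < δ)
    (hT : ∀ f, δ * ‖f‖ ^ 2 ≤ ‖inner ℂ f (T f)‖) : ∃ e : E ≃L[ℂ] E, ∀ f, e f = T f := by
  have hb : ∀ f, ‖f‖ ≤ δ⁻¹ * ‖T f‖ := by
    intro f
    rw [le_inv_mul_iff₀ hδ]
    rcases eq_or_ne f 0 with rfl | hf
    · simp
    have hf' : 0 < ‖f‖ := norm_pos_iff.mpr hf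
    have := (hT f).trans (norm_inner_le_norm f (T f))
    refine le_of_mul_le_mul_left ?_ hf'
    nlinarith
  have ha : AntilipschitzWith (⟨δ⁻¹, (inv_pos.mpr hδ).le⟩ : NNReal) T :=
    T.antilipschitz_of_bound hb
  have hc : IsClosed (T.range : Set E) := ha.isClosed_range T.uniformContinuous
  have := hc.completeSpace_coe
  have hr : T.range = ⊤ := by
    rw [← Submodule.orthogonal_eq_bot_iff, Submodule.eq_bot_iff]
    intro w hw
    have h0 : inner ℂ w (T w) = 0 := (Submodule.mem_orthogonal' _ _).mp hw _ ⟨w, rfl⟩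
    have := hT w
    rw [h0, norm_zero] at this
    have : ‖w‖ ^ 2 ≤ 0 := by
      by_contra hn
      push Not at hn
      nlinarith [mul_pos hδ hn]
    have := pow_eq_zero_iff (two_ne_zero) |>.mp (le_antisymm this (sq_nonneg _))
    simpa using this
  exact ⟨ContinuousLinearEquiv.ofBijective T (LinearMap.ker_eq_bot.mpr ha.injective) hr,
    fun f => rfl⟩

lemma inner_M (a : ℤ → ℝ) (ha1 : ∀ k, om k ^ 2 ≤ 1 + a k) (h : Wt om C)
    (M : E →L[ℂ] E) (hM : ∀ f k, M f k = ((a k * ((om k)⁻¹) ^ 2 : ℝ) : ℂ) * f k)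
    (W : E →L[ℂ] E) (hW : ∀ f k, W f k = ((om k)⁻¹ : ℝ) * f k) (f : E) :
    (inner ℂ f (M f)).im = 0 ∧ ‖f‖ ^ 2 - ‖W f‖ ^ 2 ≤ (inner ℂ f (M f)).re := by
  have hp : ∀ k, 0 < om k := fun k => zero_lt_one.trans_le (h.one_le k)
  have hs := lp.hasSum_inner (𝕜 := ℂ) f (M f)
  have e : ∀ k, inner ℂ (f k) (M f k) = ((a k * ((om k)⁻¹) ^ 2 * ‖f k‖ ^ 2 : ℝ) : ℂ) := by
    intro k
    rw [hM, RCLike.inner_apply, mul_assoc, RCLike.mul_conj]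
    push_cast
    rfl
  simp only [e] at hs
  have hre := Complex.hasSum_re hs
  have him := Complex.hasSum_im hs
  simp only [Complex.ofReal_re, Complex.ofReal_im] at hre him
  refine ⟨him.unique hasSum_zero, ?_⟩
  rw [E_norm_sq, E_norm_sq, ← (E_summable f).tsum_sub (E_summable (W f)), ← hre.tsum_eq]
  refine ((E_summable f).sub (E_summable (W f))).tsum_le_tsum (fun k => ?_) hre.summable
  rw [hW, norm_mul, Complex.norm_real, Real.norm_of_nonneg (inv_nonneg.mpr (hp k).le), mul_pow]
  have e2 : om k ^ 2 * ((om k)⁻¹) ^ 2 = 1 := by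
    rw [← mul_pow, mul_inv_cancel₀ (hp k).ne', one_pow]
  have : 0 ≤ (1 + a k - om k ^ 2) * (((om k)⁻¹) ^ 2 * ‖f k‖ ^ 2) :=
    mul_nonneg (by linarith [ha1 k]) (by positivity)
  linear_combination this - ‖f k‖ ^ 2 * e2

lemma inner_WW (W : E →L[ℂ] E) (hW : ∀ f k, W f k = ((om k)⁻¹ : ℝ) * f k) (f : E) :
    inner ℂ f (W (W f)) = ((‖W f‖ ^ 2 : ℝ) : ℂ) := by
  have : inner ℂ f (W (W f)) = inner ℂ (W f) (W f) := by
    rw [lp.inner_eq_tsum, lp.inner_eq_tsum]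
    congr 1
    ext k
    rw [hW (W f), RCLike.inner_apply, RCLike.inner_apply, hW f]
    simp only [map_mul, Complex.conj_ofReal]
    ring
  rw [this, inner_self_eq_norm_sq_to_K]
  push_cast
  rfl

lemma key_est (a : ℤ → ℝ) (ha1 : ∀ k, om k ^ 2 ≤ 1 + a k) (h : Wt om C) (V : ℤ → ℂ)
    (hV : Summable fun k => ((om k)⁻¹ * ‖V k‖) ^ 2) (B : E →L[ℂ] E)
    (hB : ∀ f k, B f k = ((om k)⁻¹ : ℝ) * conv V (fun j => ((om j)⁻¹ : ℝ) * f j) k)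
    (M : E →L[ℂ] E) (hM : ∀ f k, M f k = ((a k * ((om k)⁻¹) ^ 2 : ℝ) : ℂ) * f k)
    (W : E →L[ℂ] E) (hW : ∀ f k, W f k = ((om k)⁻¹ : ℝ) * f k) (ε : ℝ) (hε : 0 < ε) :
    ∃ c : ℝ, 0 ≤ c ∧ ∀ f, ε / 2 * ‖f‖ ^ 2 + |(inner ℂ f ((M + B) f)).im| ≤
      ε * (inner ℂ f ((M + B) f)).re + c * ‖W f‖ ^ 2 := by
  obtain ⟨D, hD, hD'⟩ := form_small h V hV B hB W hW (ε / (2 * (1 + ε))) (by positivity)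
  refine ⟨ε + (1 + ε) * D, by positivity, fun f => ?_⟩
  obtain ⟨h1, h2⟩ := inner_M a ha1 h M hM W hW f
  have h3 := hD' f
  have e : inner ℂ f ((M + B) f) = inner ℂ f (M f) + inner ℂ f (B f) := by
    rw [add_apply, inner_add_right]
  rw [e, Complex.add_im, Complex.add_re, h1, zero_add]
  have h4 := Complex.abs_im_le_norm (inner ℂ f (B f))
  have h5 := neg_le_of_abs_le (Complex.abs_re_le_norm (inner ℂ f (B f)))
  have h6 : (1 + ε) * ‖inner ℂ f (B f)‖ ≤ ε / 2 * ‖f‖ ^ 2 + (1 + ε) * D * ‖W f‖ ^ 2 := by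
    calc _ ≤ (1 + ε) * (ε / (2 * (1 + ε)) * ‖f‖ ^ 2 + D * ‖W f‖ ^ 2) := by gcongr
      _ = _ := by field_simp
  have h7 := mul_le_mul_of_nonneg_left h2 hε.le
  have h8 := mul_le_mul_of_nonneg_left h5 hε.le
  nlinarith

end

lemma om_wt (m : ℕ) (hm : 1 ≤ m) : Wt (fun k : ℤ => (1 + 2 * |(k : ℝ)|) ^ m) (2 ^ m) where
  one_le k := one_le_pow₀ (by linarith [abs_nonneg (k : ℝ)])
  sub_le k j := by
    have hk := abs_nonneg (k : ℝ)
    have hj := abs_nonneg (j : ℝ)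
    have h1 : |((k - j : ℤ) : ℝ)| ≤ |(k : ℝ)| + |(j : ℝ)| := by
      push_cast
      exact abs_sub _ _
    have h0 := abs_nonneg ((k - j : ℤ) : ℝ)
    rcases le_total |(k : ℝ)| |(j : ℝ)| with hkj | hkj
    · calc (1 + 2 * |((k - j : ℤ) : ℝ)|) ^ m ≤ (2 * (1 + 2 * |(j : ℝ)|)) ^ m := by
            gcongr; linarith
        _ = 2 ^ m * (0 + (1 + 2 * |(j : ℝ)|) ^ m) := by rw [mul_pow, zero_add]
        _ ≤ _ := by gcongr; positivity
    · calc (1 + 2 * |((k - j : ℤ) : ℝ)|) ^ m ≤ (2 * (1 + 2 * |(k : ℝ)|)) ^ m := by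
            gcongr; linarith
        _ = 2 ^ m * ((1 + 2 * |(k : ℝ)|) ^ m + 0) := by rw [mul_pow, add_zero]
        _ ≤ _ := by gcongr; positivity
  C_nonneg := by positivity
  summ := by
    have h1 : Summable fun k : ℤ => 1 / (k : ℝ) ^ 2 :=
      Real.summable_one_div_int_pow.mpr (by norm_num)
    have h2 : Summable fun k : ℤ => (if k = 0 then (1 : ℝ) else 0) :=
      summable_of_ne_finset_zero (s := {0}) fun k hk => by
        simp at hk
        simp [hk]
    refine Summable.of_nonneg_of_le (fun k => sq_nonneg _) (fun k => ?_) (h1.add h2)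
    have hk := abs_nonneg (k : ℝ)
    by_cases h0 : k = 0
    · simp [h0]
    · have hk' : 0 < |(k : ℝ)| := by simpa using h0
      simp only [h0, if_false, add_zero]
      rw [← inv_pow, one_div, ← sq_abs (k : ℝ), ← inv_pow]
      gcongr
      rw [inv_pow]
      gcongr
      calc |(k : ℝ)| ≤ (1 + 2 * |(k : ℝ)|) ^ 1 := by linarith
        _ ≤ _ := pow_le_pow_right₀ (by linarith) hm

lemma wtp_pos_eq (m : ℕ) (k : ℤ) : wtp (m : ℝ) k = ((1 + 2 * |(k : ℝ)|) ^ m) ^ 2 := by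
  unfold wtp
  rw [show (2 * (m : ℝ)) = ((m * 2 : ℕ) : ℝ) by push_cast; ring, Real.rpow_natCast, ← pow_mul]
  simp [abs_mul]

lemma wtp_neg_eq (m : ℕ) (k : ℤ) :
    wtp (-(m : ℝ)) k = (((1 + 2 * |(k : ℝ)|) ^ m)⁻¹) ^ 2 := by
  rw [inv_pow, ← wtp_pos_eq]
  unfold wtp
  rw [mul_neg, Real.rpow_neg]
  have := abs_nonneg (2 * k)
  positivity

lemma cplus_lower (m : ℕ) (hm : 1 ≤ m) (k : ℤ) :
    ((1 + 2 * |(k : ℝ)|) ^ m) ^ 2 ≤ 1 + cplus m k := by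
  unfold cplus
  by_cases h0 : k = 0
  · simp [h0]
  · have hk' : 1 ≤ |(k : ℝ)| := by exact_mod_cast Int.one_le_abs h0
    have e : (2 * Real.pi * (k : ℝ)) ^ (2 * m) = ((2 * Real.pi * |(k : ℝ)|) ^ m) ^ 2 := by
      rw [pow_mul, mul_pow, ← sq_abs (k : ℝ), ← mul_pow, ← pow_mul, ← pow_mul, mul_comm m 2]
    rw [e]
    have : ((1 + 2 * |(k : ℝ)|) ^ m) ^ 2 ≤ ((2 * Real.pi * |(k : ℝ)|) ^ m) ^ 2 := by
      gcongr
      nlinarith [Real.pi_gt_three]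
    linarith

lemma cplus_upper (m : ℕ) (k : ℤ) :
    |cplus m k * (((1 + 2 * |(k : ℝ)|) ^ m)⁻¹) ^ 2| ≤ (2 * Real.pi) ^ (2 * m) := by
  unfold cplus
  have hk := abs_nonneg (k : ℝ)
  have e : (2 * Real.pi * (k : ℝ)) ^ (2 * m) = (2 * Real.pi) ^ (2 * m) * (|(k : ℝ)| ^ m) ^ 2 := by
    rw [mul_pow, pow_mul (k : ℝ), ← sq_abs (k : ℝ), ← pow_mul, ← pow_mul, mul_comm m 2]
  have hp := Real.pi_pos
  rw [e, abs_of_nonneg (by positivity), mul_assoc, ← mul_pow, ← inv_pow, ← mul_pow]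
  apply mul_le_of_le_one_right (by positivity)
  apply pow_le_one₀ (by positivity)
  apply pow_le_one₀ (by positivity)
  rw [← div_eq_mul_inv, div_le_one (by positivity)]
  linarith

lemma graph_iff (m : ℕ) (hm : 1 ≤ m) (V : ℤ → ℂ) (om : ℤ → ℝ)
    (hom : ∀ k, om k = (1 + 2 * |(k : ℝ)|) ^ m) (B : E →L[ℂ] E)
    (hB : ∀ f k, B f k = ((om k)⁻¹ : ℝ) * conv V (fun j => ((om j)⁻¹ : ℝ) * f j) k)
    (M : E →L[ℂ] E) (hM : ∀ f k, M f k = ((cplus m k * ((om k)⁻¹) ^ 2 : ℝ) : ℂ) * f k)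
    (W : E →L[ℂ] E) (hW : ∀ f k, W f k = ((om k)⁻¹ : ℝ) * f k) (u v : E) :
    (u, v) ∈ graphS m V ↔ ∃ f, W f = u ∧ (M + B) f = W v := by
  have hp : ∀ k, 0 < om k := fun k => by
    rw [hom]
    positivity
  have hne : ∀ k, (((om k)⁻¹ : ℝ) : ℂ) ≠ 0 := fun k =>
    Complex.ofReal_ne_zero.mpr (inv_ne_zero (hp k).ne')
  have aux : ∀ f : E, (∀ k, v k = ((cplus m k : ℝ) : ℂ) * W f k + conv V (fun j => W f j) k) ↔
      (M + B) f = W v := by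
    intro f
    have ec : ∀ k, (M + B) f k = (((om k)⁻¹ : ℝ) : ℂ) *
        (((cplus m k : ℝ) : ℂ) * W f k + conv V (fun j => W f j) k) := by
      intro k
      change M f k + B f k = _
      rw [hM, hB]
      simp only [hW]
      push_cast
      ring
    constructor
    · intro hv
      ext k
      rw [ec, hW v, hv]
    · intro hv k
      have := ec k
      rw [hv, hW v] at this
      exact mul_left_cancel₀ (hne k) this
  constructor
  · rintro ⟨hs, hv⟩
    have hmem : Summable fun k => ‖((om k : ℝ) : ℂ) * u k‖ ^ 2 := by
      refine hs.congr fun k => ?_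
      rw [wtp_pos_eq, ← hom, norm_mul, mul_pow, Complex.norm_real, Real.norm_of_nonneg (hp k).le]
    let f : E := ⟨fun k => ((om k : ℝ) : ℂ) * u k, E_mem _ hmem⟩
    have hf : W f = u := by
      ext k
      rw [hW]
      change (((om k)⁻¹ : ℝ) : ℂ) * (((om k : ℝ) : ℂ) * u k) = u k
      rw [← mul_assoc, ← Complex.ofReal_mul, inv_mul_cancel₀ (hp k).ne', Complex.ofReal_one, one_mul]
    refine ⟨f, hf, (aux f).mp ?_⟩
    rw [hf]
    exact hv
  · rintro ⟨f, rfl, hf⟩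
    refine ⟨?_, (aux f).mpr hf⟩
    refine (E_summable f).congr fun k => ?_
    change _ = wtp (m : ℝ) k * ‖W f k‖ ^ 2
    rw [wtp_pos_eq, ← hom, hW, norm_mul, mul_pow, Complex.norm_real,
      Real.norm_of_nonneg (inv_nonneg.mpr (hp k).le), ← mul_assoc, ← mul_pow,
      mul_inv_cancel₀ (hp k).ne', one_pow, one_mul]

lemma L2inner_eq (om : ℤ → ℝ)
    (W : E →L[ℂ] E) (hW : ∀ f k, W f k = ((om k)⁻¹ : ℝ) * f k) (f v : E) :
    L2inner v (W f) = inner ℂ f (W v) := by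
  rw [lp.inner_eq_tsum]
  unfold L2inner
  congr 1
  ext k
  rw [hW, hW, RCLike.inner_apply]
  simp only [map_mul, Complex.conj_ofReal]
  ring

theorem sectorial_arbitrary_angle (m : ℕ) (hm : 1 ≤ m) (V : ℤ → ℂ)
    (hV : Summable fun k : ℤ => wtp (-(m : ℝ)) k * ‖V k‖ ^ 2) :
    ∀ ε > (0 : ℝ), ∃ c ≥ (0 : ℝ),
      -- numerical range estimate
      (∀ p ∈ graphS m V,
        |(L2inner p.2 p.1).im| ≤ ε * (L2inner p.2 p.1).re + c * ‖p.1‖ ^ 2) ∧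
      -- the exterior of the sector {λ : |Im λ| ≤ ε (Re λ + c)} is in the
      -- resolvent set of S₊(V)
      (∀ lam : ℂ, ε * (lam.re + c) < |lam.im| →
        ∃ R : E →L[ℂ] E, ResolventAt (graphS m V) lam R) := by
  intro ε hε
  obtain ⟨om, hom⟩ : ∃ om : ℤ → ℝ, om = fun k : ℤ => (1 + 2 * |(k : ℝ)|) ^ m := ⟨_, rfl⟩
  have hom' : ∀ k, om k = (1 + 2 * |(k : ℝ)|) ^ m := fun k => by rw [hom]
  have h : Wt om (2 ^ m) := hom ▸ om_wt m hm
  have hV' : Summable fun k => ((om k)⁻¹ * ‖V k‖) ^ 2 := by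
    refine hV.congr fun k => ?_
    rw [wtp_neg_eq, hom', mul_pow]
  obtain ⟨B, hB⟩ := exists_B h V hV'
  obtain ⟨M, hM⟩ := exists_mul (fun k => cplus m k * ((om k)⁻¹) ^ 2) _ (fun k => by
    rw [hom']
    exact cplus_upper m k)
  obtain ⟨W, hW⟩ := exists_mul (fun k => (om k)⁻¹) 1 (fun k => by
    have := h.one_le k
    rw [abs_of_nonneg (by positivity)]
    exact inv_le_one_of_one_le₀ this)
  obtain ⟨c, hc, hkey⟩ := key_est (cplus m) (fun k => by rw [hom']; exact cplus_lower m hm k)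
    h V hV' B hB M hM W hW ε hε
  have hg := graph_iff m hm V om hom' B hB M hM W hW
  refine ⟨max c (c / ε), hc.trans (le_max_left _ _), ?_, ?_⟩
  · rintro ⟨u, v⟩ hp
    obtain ⟨f, rfl, hf⟩ := (hg u v).mp hp
    have := hkey f
    rw [hf] at this
    rw [L2inner_eq om W hW]
    have h1 : c * ‖W f‖ ^ 2 ≤ max c (c / ε) * ‖W f‖ ^ 2 := by
      gcongr
      exact le_max_left _ _
    have h2 : 0 ≤ ε / 2 * ‖f‖ ^ 2 := by positivity
    linarith
  · intro lam hlam
    have hlam' : ε * lam.re + c < |lam.im| := by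
      have : c ≤ ε * max c (c / ε) := by
        calc c = ε * (c / ε) := by field_simp
          _ ≤ _ := by gcongr; exact le_max_right _ _
      linarith
    let T : E →L[ℂ] E := (M + B) - lam • (W.comp W)
    have hT : ∀ f, T f = (M + B) f - lam • W (W f) := fun f => rfl
    obtain ⟨e, he⟩ := coercive_equiv T (ε / (2 * (1 + ε))) (by positivity) (fun f => by
      have k1 := hkey f
      have eT : inner ℂ f (T f) = inner ℂ f ((M + B) f) - lam * ((‖W f‖ ^ 2 : ℝ) : ℂ) := by
        rw [hT, inner_sub_right, inner_smul_right, inner_WW W hW]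
      have er : (inner ℂ f (T f)).re = (inner ℂ f ((M + B) f)).re - lam.re * ‖W f‖ ^ 2 := by
        rw [eT, Complex.sub_re, Complex.re_mul_ofReal]
      have ei : (inner ℂ f (T f)).im = (inner ℂ f ((M + B) f)).im - lam.im * ‖W f‖ ^ 2 := by
        rw [eT, Complex.sub_im, Complex.im_mul_ofReal]
      have n1 := Complex.abs_re_le_norm (inner ℂ f (T f))
      have n2 := Complex.abs_im_le_norm (inner ℂ f (T f))
      have n3 := le_of_abs_le n1
      have k2 : |lam.im| * ‖W f‖ ^ 2 ≤ |(inner ℂ f ((M + B) f)).im| + |(inner ℂ f (T f)).im| := by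
        calc |lam.im| * ‖W f‖ ^ 2 = |lam.im * ‖W f‖ ^ 2| := by
              rw [abs_mul, abs_of_nonneg (sq_nonneg ‖W f‖)]
          _ = |(inner ℂ f ((M + B) f)).im - (inner ℂ f (T f)).im| := by
              rw [ei]
              congr 1
              ring
          _ ≤ _ := abs_sub _ _
      have k3 := mul_le_mul_of_nonneg_right hlam'.le (sq_nonneg ‖W f‖)
      have k4 := mul_le_mul_of_nonneg_left n3 hε.le
      rw [er] at k4
      have k5 : ε / 2 * ‖f‖ ^ 2 ≤ (1 + ε) * ‖inner ℂ f (T f)‖ := by linarith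
      calc ε / (2 * (1 + ε)) * ‖f‖ ^ 2 = (ε / 2 * ‖f‖ ^ 2) / (1 + ε) := by field_simp
        _ ≤ _ := by
          rw [div_le_iff₀ (by positivity)]
          linarith)
    refine ⟨W.comp ((e.symm : E →L[ℂ] E).comp W), fun w => ?_, ?_⟩
    · refine (hg _ _).mpr ⟨e.symm (W w), rfl, ?_⟩
      have h1 : T (e.symm (W w)) = W w := by rw [← he, e.apply_symm_apply]
      rw [hT, sub_eq_iff_eq_add] at h1
      rw [h1, map_add, map_smul]
      rfl
    · rintro ⟨u, v⟩ hp
      obtain ⟨f, rfl, hf⟩ := (hg u v).mp hp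
      have h1 : W (v - lam • W f) = e f := by
        rw [he, hT, hf, map_sub, map_smul]
      change W (e.symm (W (v - lam • W f))) = W f
      rw [h1, e.symm_apply_apply]
end
end
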